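/- Let N = 3, set α₃ := 2π/5 and λ₃ := (9/10) sin(α₃/16) cos(11α₃/16). Suppose mK ≤ α₃ / (4(sin(α₃/16) cos(11α₃/16) + 2) ln((4 sin(α₃/16) cos(11α₃/16) + 6)/(sin(α₃/16) cos(11α₃/16)))) and D(Ω) < λ₃ K. Then for ANY initial phases Θ(0) ∈ ℝ³ and velocities Θ'(0) ∈ ℝ³, the solution Θ(t) of the second-order Kuramoto system m θ_i''(t) + θ_i'(t) = ω_i + (K/3) Σ_{j=1}^3 sin(θ_j(t) − θ_i(t)) satisfies lim_{t→∞} θ_i'(t) = ω for all 1 ≤ i ≤ 3, where ω := (1/3) Σ_{i=1}^3 ω_i; i.e., the system exhibits unconditional complete frequency synchronization. -/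

import Mathlib

open Real Filter

/-- The diameter `D(X) = max_{i≠j} (xᵢ - xⱼ)` of a vector `X ∈ ℝ^N`
(realized as the supremum of `xᵢ - xⱼ` over all pairs). -/
noncomputable def diam {n : ℕ} (X : Fin n → ℝ) : ℝ :=
  ⨆ p : Fin n × Fin n, (X p.1 - X p.2)

/-- A differentiable function that strictly decreases whenever it meets the level `b`
never exceeds `b` again. -/
lemma le_of_deriv_neg_at_level {z z' : ℝ → ℝ} {t₀ b : ℝ}
    (hz : ∀ t, t₀ ≤ t → HasDerivAt z (z' t) t) (h₀ : z t₀ ≤ b)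
    (hb : ∀ t, t₀ ≤ t → z t = b → z' t < 0) :
    ∀ t, t₀ ≤ t → z t ≤ b := by
  intro t ht
  refine image_le_of_deriv_right_lt_deriv_boundary' (f := z) (f' := z') (a := t₀) (b := t)
    (B := fun _ => b) (B' := fun _ => 0) ?_ ?_ h₀ continuousOn_const ?_ ?_ ⟨ht, le_rfl⟩
  · exact fun s hs => (hz s hs.1).continuousAt.continuousWithinAt
  · exact fun s hs => (hz s hs.1).hasDerivWithinAt
  · exact fun s _ => hasDerivWithinAt_const _ _ _
  · exact fun s hs => hb s hs.1

/-- If `m p' + p ≤ B`, then eventually `p ≤ B'` for each `B' > B`. -/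
lemma eventually_le_of_relaxation {m B B' : ℝ} (hm : 0 < m) (hB : B < B') {p p' : ℝ → ℝ}
    (hp : ∀ t, HasDerivAt p (p' t) t) (hg : ∀ t, 0 ≤ t → m * p' t + p t ≤ B) :
    ∀ᶠ t in atTop, p t ≤ B' := by
  have hder : ∀ t, HasDerivAt (fun s => exp (s / m) * (p s - B))
      (exp (t / m) * (1 / m) * (p t - B) + exp (t / m) * p' t) t := fun t =>
    (((hasDerivAt_id t).div_const m).exp).mul ((hp t).sub_const B)
  have hanti : AntitoneOn (fun s => exp (s / m) * (p s - B)) (Set.Ici 0) := by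
    refine antitoneOn_of_hasDerivWithinAt_nonpos (convex_Ici 0)
      (fun t _ => (hder t).continuousAt.continuousWithinAt)
      (fun t _ => (hder t).hasDerivWithinAt) ?_
    intro t ht
    rw [interior_Ici] at ht
    have h := hg t (le_of_lt ht)
    have : exp (t / m) * (1 / m) * (p t - B) + exp (t / m) * p' t
        = exp (t / m) / m * (m * p' t + p t - B) := by
      field_simp
      ring
    rw [this]
    exact mul_nonpos_of_nonneg_of_nonpos (by positivity) (by linarith)
  have hlim : Tendsto (fun t => exp (t / m) * (B' - B)) atTop atTop :=
    (tendsto_exp_atTop.comp (tendsto_id.atTop_div_const hm)).atTop_mul_const (by linarith)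
  filter_upwards [hlim.eventually_ge_atTop (p 0 - B), eventually_ge_atTop 0] with t h1 h2
  have h3 := hanti (Set.mem_Ici.2 le_rfl) (Set.mem_Ici.2 h2) h2
  simp only [zero_div, exp_zero, one_mul] at h3
  have := le_of_mul_le_mul_left (h3.trans h1) (exp_pos _)
  linarith

lemma eventually_abs_le_of_relaxation {m B B' : ℝ} (hm : 0 < m) (hB : B < B') {p p' : ℝ → ℝ}
    (hp : ∀ t, HasDerivAt p (p' t) t) (hg : ∀ t, 0 ≤ t → |m * p' t + p t| ≤ B) :
    ∀ᶠ t in atTop, |p t| ≤ B' := by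
  have h1 := eventually_le_of_relaxation hm hB hp fun t ht => (abs_le.1 (hg t ht)).2
  have h2 := eventually_le_of_relaxation hm hB (fun t => (hp t).neg) fun t ht => by
    have := (abs_le.1 (hg t ht)).1
    show m * -p' t + -p t ≤ B
    linarith
  filter_upwards [h1, h2] with t h1 h2
  have h2 : -p t ≤ B' := h2
  exact abs_le.2 ⟨by linarith, h1⟩

/-- Two oscillators at distance at most `1` stay at distance at most `6/5`, wherever the third
one is. -/
lemma phase_gap_le {K η t₀ : ℝ} (hK : 0 < K) (hη : η < K / 10) {δ z ψ : ℝ → ℝ}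
    (hz : ∀ t, t₀ ≤ t →
      HasDerivAt z (η - 2 * K / 3 * (sin (δ t / 2) * (2 * cos (δ t / 2) + cos (ψ t)))) t)
    (hclose : ∀ t, t₀ ≤ t → |z t - δ t| ≤ 1 / 10) (h₀ : δ t₀ ≤ 1) :
    ∀ t, t₀ ≤ t → δ t ≤ 6 / 5 := by
  have key := le_of_deriv_neg_at_level (b := 11 / 10) hz
    (by have := (abs_le.1 (hclose t₀ le_rfl)).2; linarith) (by
      intro t ht h
      have hc := abs_le.1 (hclose t ht)
      have hx1 : 1 / 2 ≤ δ t / 2 := by linarith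
      have hx2 : δ t / 2 ≤ 3 / 5 := by linarith
      generalize δ t / 2 = x at hx1 hx2 ⊢
      have hs : 9 / 20 ≤ sin x := by
        have := sin_gt_sub_cube (x := x) (by linarith)
        nlinarith [mul_nonneg (sub_nonneg.2 hx1) (sub_nonneg.2 hx2)]
      have hcos : 41 / 50 ≤ cos x := by
        have := one_sub_sq_div_two_le_cos (x := x)
        nlinarith
      have hprod : 9 / 20 * (16 / 25) ≤ sin x * (2 * cos x + cos (ψ t)) :=
        mul_le_mul hs (by linarith [neg_one_le_cos (ψ t)]) (by norm_num) (by linarith)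
      nlinarith)
  intro t ht
  have := key t ht
  have := abs_le.1 (hclose t ht)
  linarith

/-- A phase whose relaxed version `w` decreases while the sine is large is bounded above. -/
lemma phase_bddAbove {t₀ : ℝ} {ψ w w' : ℝ → ℝ}
    (hw : ∀ t, t₀ ≤ t → HasDerivAt w (w' t) t)
    (hclose : ∀ t, t₀ ≤ t → |w t - ψ t| ≤ 1 / 10)
    (hneg : ∀ t, t₀ ≤ t → 1 / 2 ≤ sin (ψ t) → w' t < 0) :
    ∃ C, ∀ t, t₀ ≤ t → ψ t ≤ C := by
  obtain ⟨n, hn⟩ := exists_nat_gt (w t₀)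
  have hb : w t₀ ≤ π / 2 + n * (2 * π) := by
    have : (n : ℝ) * 1 ≤ n * (2 * π) :=
      mul_le_mul_of_nonneg_left (by linarith [pi_gt_three]) (Nat.cast_nonneg n)
    linarith [pi_pos]
  refine ⟨π / 2 + n * (2 * π) + 1 / 10, fun t ht => ?_⟩
  have := le_of_deriv_neg_at_level hw hb (fun s hs h => hneg s hs (by
    have hc := abs_le.1 (hclose s hs)
    have : sin (ψ s) = cos (π / 2 + n * (2 * π) - ψ s) := by
      rw [show π / 2 + n * (2 * π) - ψ s = (π / 2 - ψ s) + n * (2 * π) by ring,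
        cos_add_nat_mul_two_pi, cos_pi_div_two_sub]
    rw [this, ← h]
    have := one_sub_sq_div_two_le_cos (x := w s - ψ s)
    nlinarith)) t ht
  have := abs_le.1 (hclose t ht)
  linarith

/-- A continuous function avoiding all multiples of `2π` stays bounded above. -/
lemma bddAbove_of_avoids_two_pi_mul {d : ℝ → ℝ} (hd : Continuous d) {T : ℝ}
    (h : ∀ t, T ≤ t → ∀ n : ℤ, d t ≠ n * (2 * π)) : ∃ C, ∀ t, T ≤ t → d t ≤ C := by
  obtain ⟨n, hn⟩ := exists_nat_gt (d T)
  have hb : d T ≤ n * (2 * π) := by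
    have : (n : ℝ) * 1 ≤ n * (2 * π) :=
      mul_le_mul_of_nonneg_left (by linarith [pi_gt_three]) (Nat.cast_nonneg n)
    linarith
  refine ⟨n * (2 * π), fun t ht => ?_⟩
  by_contra! hlt
  obtain ⟨s, hs, hd_eq⟩ := intermediate_value_Icc ht hd.continuousOn ⟨hb, hlt.le⟩
  exact h s hs.1 n (by simpa using hd_eq)

/-- Barbalat's lemma in Lyapunov form: if `E' = -f ≤ 0`, `E` is bounded below and `f` has bounded
derivative, then `f` tends to zero. -/
lemma tendsto_zero_of_dissipation {E f f' : ℝ → ℝ} {T L C : ℝ}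
    (hE : ∀ t, T ≤ t → HasDerivAt E (-f t) t) (hf : ∀ t, T ≤ t → HasDerivAt f (f' t) t)
    (hf0 : ∀ t, T ≤ t → 0 ≤ f t) (hL : ∀ t, T ≤ t → L ≤ E t)
    (hC : ∀ t, T ≤ t → |f' t| ≤ C) : Tendsto f atTop (nhds 0) := by
  have hC0 : 0 ≤ C := (abs_nonneg _).trans (hC T le_rfl)
  have hanti : ∀ s t, T ≤ s → s ≤ t → E t ≤ E s := by
    intro s t hs hst
    refine antitoneOn_of_hasDerivWithinAt_nonpos (convex_Ici T)
      (fun t ht => (hE t ht).continuousAt.continuousWithinAt)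
      (fun t ht => (hE t (interior_subset ht)).hasDerivWithinAt) ?_ hs (hs.trans hst) hst
    exact fun t ht => neg_nonpos.2 (hf0 t (interior_subset ht))
  have hconv : ∃ l, Tendsto E atTop (nhds l) := by
    have hA : Antitone fun t => E (max T t) := fun s t hst =>
      hanti _ _ (le_max_left _ _) (max_le_max le_rfl hst)
    have hB : BddBelow (Set.range fun t => E (max T t)) :=
      ⟨L, by rintro _ ⟨t, rfl⟩; exact hL _ (le_max_left _ _)⟩
    refine ⟨_, (tendsto_atTop_ciInf hA hB).congr' ?_⟩
    filter_upwards [eventually_ge_atTop T] with t ht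
    rw [max_eq_right ht]
  obtain ⟨l, hl⟩ := hconv
  rw [Metric.tendsto_atTop']
  intro ε hε
  set h := ε / (2 * (C + 1)) with hh
  have hpos : 0 < h := by positivity
  have hdiff : Tendsto (fun t => (E t - E (t + h)) / h) atTop (nhds 0) := by
    have := (hl.sub (hl.comp (tendsto_atTop_add_const_right atTop h tendsto_id))).div_const h
    simpa using this
  have hev := (hdiff.eventually_lt_const (show (0 : ℝ) < ε / 2 by positivity)).and
    (eventually_ge_atTop T)
  obtain ⟨N, hN⟩ := eventually_atTop.1 hev
  refine ⟨N, fun t ht => ?_⟩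
  obtain ⟨h1, htT⟩ := hN t ht.le
  obtain ⟨ξ, hξ, hξ'⟩ := exists_hasDerivAt_eq_slope E (fun s => -f s) (show t < t + h by linarith)
    (fun s hs => (hE s (htT.trans hs.1)).continuousAt.continuousWithinAt)
    (fun s hs => hE s (htT.trans hs.1.le))
  have hfξ : f ξ < ε / 2 := by
    have : f ξ = (E t - E (t + h)) / h := by
      rw [eq_div_iff hpos.ne']
      rw [eq_div_iff (by linarith)] at hξ'
      linarith
    rwa [this]
  have hvar : |f ξ - f t| ≤ C * |ξ - t| := by
    have := (convex_Ici T).norm_image_sub_le_of_norm_hasDerivWithin_le (f := f) (f' := f')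
      (C := C) (fun s hs => (hf s hs).hasDerivWithinAt) (fun s hs => hC s hs)
      (show t ∈ Set.Ici T from htT) (show ξ ∈ Set.Ici T from htT.trans hξ.1.le)
    simpa using this
  have hle : C * |ξ - t| ≤ ε / 2 := by
    rw [abs_of_pos (by linarith [hξ.1])]
    calc C * (ξ - t) ≤ (C + 1) * h :=
          mul_le_mul (by linarith) (by linarith [hξ.2]) (by linarith [hξ.1]) (by linarith)
      _ = ε / 2 := by rw [hh]; field_simp
  have := (abs_le.1 hvar).1
  rw [Real.dist_eq, sub_zero, abs_of_nonneg (hf0 t htT)]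
  linarith

lemma Fin.sum_univ_three_of_ne {i j k : Fin 3} (hij : i ≠ j) (hik : i ≠ k) (hjk : j ≠ k)
    (f : Fin 3 → ℝ) : ∑ l, f l = f i + f j + f k := by
  rw [Fin.sum_univ_three]
  fin_cases i <;> fin_cases j <;> fin_cases k <;> simp_all <;> ring

lemma Fin.exists_third (i j : Fin 3) (hij : i ≠ j) :
    ∃ k, i ≠ k ∧ j ≠ k ∧ ∀ l, l = i ∨ l = j ∨ l = k := by
  revert i j
  decide

lemma sin_mul_cos_bounds : 0 < sin ((2 * π / 5) / 16) * cos (11 * (2 * π / 5) / 16) ∧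
    sin ((2 * π / 5) / 16) * cos (11 * (2 * π / 5) / 16) ≤ 2 / 25 := by
  have hs : 0 < sin ((2 * π / 5) / 16) :=
    sin_pos_of_pos_of_lt_pi (by positivity) (by linarith [pi_pos])
  have hc : 0 < cos (11 * (2 * π / 5) / 16) :=
    cos_pos_of_mem_Ioo ⟨by linarith [pi_pos], by linarith [pi_pos]⟩
  refine ⟨mul_pos hs hc, ?_⟩
  calc _ ≤ sin ((2 * π / 5) / 16) * 1 := mul_le_mul_of_nonneg_left (cos_le_one _) hs.le
    _ ≤ (2 * π / 5) / 16 := by rw [mul_one]; exact sin_le (by positivity)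
    _ ≤ 2 / 25 := by linarith [pi_lt_d2]

lemma inertia_threshold_le {s : ℝ} (h0 : 0 < s) (h1 : s ≤ 2 / 25) :
    (2 * π / 5) / (4 * (s + 2) * log ((4 * s + 6) / s)) ≤ 1 / 25 := by
  have hlog : 4 ≤ log ((4 * s + 6) / s) := by
    rw [le_log_iff_exp_le (by positivity)]
    have he : exp 4 ≤ 75 := by
      have h := exp_one_lt_d9.le
      calc exp 4 = exp 1 ^ 4 := by rw [← exp_nat_mul]; norm_num
        _ ≤ 2.7182818286 ^ 4 := pow_le_pow_left₀ (exp_pos 1).le h 4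
        _ ≤ 75 := by norm_num
    refine he.trans ?_
    rw [le_div_iff₀ h0]
    linarith
  have hden : 32 ≤ 4 * (s + 2) * log ((4 * s + 6) / s) := by nlinarith
  rw [div_le_iff₀ (by linarith)]
  linarith [pi_lt_d2]

lemma sub_le_diam {n : ℕ} (X : Fin n → ℝ) (i j : Fin n) : X i - X j ≤ diam X :=
  le_ciSup (f := fun p : Fin n × Fin n => X p.1 - X p.2) (Set.finite_range _).bddAbove (i, j)

/-- If two oscillators get within distance `1` of each other, then they and the third one stay at
bounded distance. Here `δ` is the gap of the pair, `ψ` the position of the third oscillator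
relative to the midpoint of the pair, and `z`, `w` are the relaxed versions `δ + m δ'`,
`ψ + m ψ'`. -/
lemma pair_traps_third {K η ζ t₀ : ℝ} (hK : 0 < K) (hη : |η| < K / 10) (hζ : |ζ| < K / 10)
    {δ z ψ w : ℝ → ℝ}
    (hz : ∀ t, t₀ ≤ t →
      HasDerivAt z (η - 2 * K / 3 * (sin (δ t / 2) * (2 * cos (δ t / 2) + cos (ψ t)))) t)
    (hw : ∀ t, t₀ ≤ t → HasDerivAt w (ζ - K * (cos (δ t / 2) * sin (ψ t))) t)
    (hzδ : ∀ t, t₀ ≤ t → |z t - δ t| ≤ 1 / 10) (hwψ : ∀ t, t₀ ≤ t → |w t - ψ t| ≤ 1 / 10)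
    (h₀ : |δ t₀| ≤ 1) :
    ∃ C, ∀ t, t₀ ≤ t → |δ t| ≤ C ∧ |ψ t| ≤ C := by
  rw [abs_lt] at hη hζ
  rw [abs_le] at h₀
  have hneg : ∀ x y : ℝ, |(-x) - (-y)| = |x - y| := fun x y => by
    rw [← abs_neg]; congr 1; ring
  have hδ1 := phase_gap_le hK hη.2 hz hzδ h₀.2
  have hδ2 := phase_gap_le (η := -η) (δ := fun t => -δ t) (z := fun t => -z t) (ψ := ψ) (t₀ := t₀)
    hK (by linarith) (fun t ht => by
      have := (hz t ht).neg
      rw [neg_div, sin_neg, cos_neg]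
      exact this.congr_deriv (by ring)) (fun t ht => by rw [hneg]; exact hzδ t ht) (by linarith)
  have hcos : ∀ t, t₀ ≤ t → 4 / 5 ≤ cos (δ t / 2) := fun t ht => by
    have h1 := hδ1 t ht
    have h2 : -δ t ≤ 6 / 5 := hδ2 t ht
    have := one_sub_sq_div_two_le_cos (x := δ t / 2)
    nlinarith
  obtain ⟨C₁, hC₁⟩ := phase_bddAbove hw hwψ fun t ht hs => by
    nlinarith [mul_le_mul (hcos t ht) hs (by norm_num) (by linarith [hcos t ht])]
  obtain ⟨C₂, hC₂⟩ := phase_bddAbove (w := fun t => -w t) (ψ := fun t => -ψ t) (t₀ := t₀)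
    (fun t ht => (hw t ht).neg) (fun t ht => by rw [hneg]; exact hwψ t ht) fun t ht hs => by
      rw [sin_neg] at hs
      nlinarith [mul_le_mul (hcos t ht) hs (by norm_num) (by linarith [hcos t ht])]
  refine ⟨max (6 / 5) (max C₁ C₂), fun t ht => ⟨?_, ?_⟩⟩
  · have h1 := hδ1 t ht
    have h2 : -δ t ≤ 6 / 5 := hδ2 t ht
    exact (abs_le'.2 ⟨h1, h2⟩).trans (le_max_left _ _)
  · have h1 := hC₁ t ht
    have h2 : -ψ t ≤ C₂ := hC₂ t ht
    exact abs_le'.2 ⟨h1.trans ((le_max_left _ _).trans (le_max_right _ _)),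
      h2.trans ((le_max_right _ _).trans (le_max_right _ _))⟩

lemma sin_sub_add_sin_sub_pair (x y z : ℝ) :
    sin (y - x) + sin (z - x) - (sin (x - y) + sin (z - y))
      = -2 * (sin ((x - y) / 2) * (2 * cos ((x - y) / 2) + cos (z - (x + y) / 2))) := by
  rw [show y - x = -(2 * ((x - y) / 2)) by ring, show x - y = 2 * ((x - y) / 2) by ring,
    show z - x = (z - (x + y) / 2) - (x - y) / 2 by ring,
    show z - y = (z - (x + y) / 2) + (x - y) / 2 by ring,
    show 2 * ((x - y) / 2) / 2 = (x - y) / 2 by ring]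
  rw [sin_neg, sin_two_mul, sin_sub, sin_add]
  ring

lemma sin_sub_add_sin_sub_third (x y z : ℝ) :
    sin (x - z) + sin (y - z) = -2 * (cos ((x - y) / 2) * sin (z - (x + y) / 2)) := by
  rw [show x - z = (x - y) / 2 - (z - (x + y) / 2) by ring,
    show y - z = -((x - y) / 2 + (z - (x + y) / 2)) by ring,
    sin_neg, sin_sub, sin_add]
  ring

/-- Along a solution the phase differences are eventually bounded. -/
lemma phase_differences_bounded {m K : ℝ} (hm : 0 < m) (hK : 0 < K) (hmK : m * K ≤ 1 / 25)
    {ω : Fin 3 → ℝ} (hω : ∀ i j, |ω i - ω j| < K / 10) {θ v a : Fin 3 → ℝ → ℝ}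
    (hθ : ∀ i t, HasDerivAt (θ i) (v i t) t) (hv : ∀ i t, HasDerivAt (v i) (a i t) t)
    (hode : ∀ i, ∀ t : ℝ, 0 ≤ t →
      m * a i t + v i t = ω i + K / 3 * ∑ j, sin (θ j t - θ i t)) :
    ∃ C T, 0 ≤ T ∧ ∀ t, T ≤ t → ∀ i j, |θ i t - θ j t| ≤ C := by
  have hspeed : ∀ i j, ∀ᶠ t in atTop, |v i t - v j t| ≤ 11 / 5 * K := fun i j => by
    refine eventually_abs_le_of_relaxation hm (B := 21 / 10 * K) (by linarith)
      (fun t => (hv i t).sub (hv j t)) fun t ht => ?_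
    have h1 := hode i t ht
    have h2 := hode j t ht
    have hsum : ∀ i, |∑ l, sin (θ l t - θ i t)| ≤ 3 := fun i =>
      (Finset.abs_sum_le_sum_abs _ _).trans
        ((Finset.sum_le_sum fun l _ => abs_sin_le_one _).trans (by simp))
    have hi := abs_le.1 (hsum i)
    have hj := abs_le.1 (hsum j)
    have h := abs_lt.1 (hω i j)
    rw [abs_le]
    constructor <;> nlinarith
  have hall : ∀ᶠ t in atTop, ∀ i j, |v i t - v j t| ≤ 11 / 5 * K :=
    eventually_all.2 fun i => eventually_all.2 fun j => hspeed i j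
  obtain ⟨T, hT⟩ := eventually_atTop.1 (hall.and (eventually_ge_atTop 0))
  have hT0 : 0 ≤ T := (hT T le_rfl).2
  have hmv : ∀ t, T ≤ t → ∀ i j, |m * (v i t - v j t)| ≤ 1 / 10 := fun t ht i j => by
    rw [abs_mul, abs_of_pos hm]
    nlinarith [(hT t ht).1 i j]
  by_cases hclose : ∃ t₀, T ≤ t₀ ∧ ∃ i j, i ≠ j ∧ ∃ n : ℤ, |θ i t₀ - θ j t₀ - n * (2 * π)| ≤ 1
  · obtain ⟨t₀, ht₀, i, j, hij, n, hn⟩ := hclose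
    obtain ⟨k, hik, hjk, hcover⟩ := Fin.exists_third i j hij
    have hlift : ∀ p t, HasDerivAt (fun s => θ p s + m * v p s) (m * a p t + v p t) t :=
      fun p t => ((hθ p t).add ((hv p t).const_mul m)).congr_deriv (add_comm _ _)
    have hshift : ∀ x y : ℝ, sin (x - n * (2 * π) - y) = sin (x - y) ∧
        sin (y - (x - n * (2 * π))) = sin (y - x) := fun x y => by
      rw [show x - n * (2 * π) - y = x - y - n * (2 * π) by ring, sin_sub_int_mul_two_pi,
        show y - (x - n * (2 * π)) = y - x + n * (2 * π) by ring, sin_add_int_mul_two_pi]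
      exact ⟨rfl, rfl⟩
    have hζ : |ω k - (ω i + ω j) / 2| < K / 10 := by
      have h1 := abs_lt.1 (hω k i)
      have h2 := abs_lt.1 (hω k j)
      rw [abs_lt]
      constructor <;> linarith
    obtain ⟨C, hC⟩ := pair_traps_third (K := K) (t₀ := t₀) (η := ω i - ω j)
      (ζ := ω k - (ω i + ω j) / 2)
      (δ := fun t => θ i t - n * (2 * π) - θ j t)
      (ψ := fun t => θ k t - (θ i t - n * (2 * π) + θ j t) / 2)
      (z := fun t => (θ i t + m * v i t) - n * (2 * π) - (θ j t + m * v j t))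
      (w := fun t => (θ k t + m * v k t)
        - ((θ i t + m * v i t) - n * (2 * π) + (θ j t + m * v j t)) / 2)
      hK (hω i j) hζ
      (fun t ht => by
        refine (((hlift i t).sub_const _).sub (hlift j t)).congr_deriv ?_
        have h := sin_sub_add_sin_sub_pair (θ i t - n * (2 * π)) (θ j t) (θ k t)
        rw [(hshift _ _).1, (hshift _ _).2, (hshift _ _).2] at h
        rw [hode i t (hT0.trans (ht₀.trans ht)), hode j t (hT0.trans (ht₀.trans ht)),
          Fin.sum_univ_three_of_ne hij hik hjk, Fin.sum_univ_three_of_ne hij hik hjk]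
        simp only [sub_self, sin_zero]
        linear_combination K / 3 * h)
      (fun t ht => by
        refine ((hlift k t).sub
          ((((hlift i t).sub_const _).add (hlift j t)).div_const 2)).congr_deriv ?_
        have h := sin_sub_add_sin_sub_third (θ i t - n * (2 * π)) (θ j t) (θ k t)
        rw [(hshift _ _).1] at h
        have e1 : sin (θ j t - θ i t) = -sin (θ i t - θ j t) := by rw [← sin_neg, neg_sub]
        have e2 : sin (θ k t - θ i t) = -sin (θ i t - θ k t) := by rw [← sin_neg, neg_sub]
        have e3 : sin (θ k t - θ j t) = -sin (θ j t - θ k t) := by rw [← sin_neg, neg_sub]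
        rw [hode i t (hT0.trans (ht₀.trans ht)), hode j t (hT0.trans (ht₀.trans ht)),
          hode k t (hT0.trans (ht₀.trans ht)),
          Fin.sum_univ_three_of_ne hij hik hjk, Fin.sum_univ_three_of_ne hij hik hjk,
          Fin.sum_univ_three_of_ne hij hik hjk, e1, e2, e3]
        simp only [sub_self, sin_zero]
        linear_combination K / 2 * h)
      (fun t ht => by
        convert hmv t (ht₀.trans ht) i j using 2
        ring)
      (fun t ht => by
        have h1 := abs_le.1 (hmv t (ht₀.trans ht) k i)
        have h2 := abs_le.1 (hmv t (ht₀.trans ht) k j)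
        rw [abs_le]
        constructor <;> linarith)
      (by convert hn using 2; ring)
    have hdist : ∀ t, t₀ ≤ t → ∀ p,
        |θ p t - (θ i t + θ j t) / 2| ≤ C + |(n : ℝ) * (2 * π)| := fun t ht p => by
      obtain ⟨h1, h2⟩ := hC t ht
      rw [abs_le] at h1 h2
      have h3 := abs_le.1 (le_refl |(n : ℝ) * (2 * π)|)
      rw [abs_le]
      rcases hcover p with rfl | rfl | rfl <;> constructor <;> linarith
    refine ⟨2 * (C + |(n : ℝ) * (2 * π)|), t₀, hT0.trans ht₀, fun t ht p q => ?_⟩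
    have h1 := abs_le.1 (hdist t ht p)
    have h2 := abs_le.1 (hdist t ht q)
    rw [abs_le]
    constructor <;> linarith
  · push Not at hclose
    have hbdd : ∀ i j, ∃ C, ∀ t, T ≤ t → θ i t - θ j t ≤ C := fun i j => by
      by_cases hij : i = j
      · exact ⟨0, fun t _ => by simp [hij]⟩
      · refine bddAbove_of_avoids_two_pi_mul (d := fun t => θ i t - θ j t)
          (continuous_iff_continuousAt.2 fun t => ((hθ i t).sub (hθ j t)).continuousAt)
          fun t ht n h => ?_
        have := hclose t ht i j hij n
        rw [h, sub_self, abs_zero] at this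
        linarith
    choose C hC using hbdd
    have hle : ∀ i j, C i j ≤ ∑ p, ∑ q, |C p q| := fun i j =>
      (le_abs_self _).trans ((Finset.single_le_sum (f := fun q => |C i q|)
        (fun _ _ => abs_nonneg _) (Finset.mem_univ j)).trans
        (Finset.single_le_sum (f := fun p => ∑ q, |C p q|)
          (fun _ _ => Finset.sum_nonneg fun _ _ => abs_nonneg _) (Finset.mem_univ i)))
    refine ⟨∑ p, ∑ q, |C p q|, T, hT0, fun t ht i j => abs_le'.2 ⟨(hC i j t ht).trans (hle i j), ?_⟩⟩
    rw [neg_sub]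
    exact (hC j i t ht).trans (hle j i)

/-- Bounded phase differences force frequency synchronization, by dissipation of energy. -/
lemma sync_of_phase_differences_bounded {m K C T : ℝ} (hm : 0 < m) (hK : 0 < K)
    {ω : Fin 3 → ℝ} {θ v a : Fin 3 → ℝ → ℝ}
    (hθ : ∀ i t, HasDerivAt (θ i) (v i t) t) (hv : ∀ i t, HasDerivAt (v i) (a i t) t)
    (hode : ∀ i, ∀ t : ℝ, 0 ≤ t →
      m * a i t + v i t = ω i + K / 3 * ∑ j, sin (θ j t - θ i t))
    (hT : 0 ≤ T) (hC : ∀ t, T ≤ t → ∀ i j, |θ i t - θ j t| ≤ C) :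
    ∀ i, Tendsto (v i) atTop (nhds ((1 / 3 : ℝ) * ∑ k, ω k)) := by
  set Ω : ℝ := (1 / 3 : ℝ) * ∑ k, ω k with hΩ
  have hΩ' : ω 0 + ω 1 + ω 2 = 3 * Ω := by rw [hΩ, Fin.sum_univ_three]; ring
  have hforce : ∀ i t, 0 ≤ t → |m * a i t + v i t| ≤ |ω i| + K := fun i t ht => by
    have hsum : |∑ l, sin (θ l t - θ i t)| ≤ 3 :=
      (Finset.abs_sum_le_sum_abs _ _).trans
        ((Finset.sum_le_sum fun l _ => abs_sin_le_one _).trans (by simp))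
    rw [hode i t ht]
    refine (abs_add_le _ _).trans (add_le_add le_rfl ?_)
    rw [abs_mul, abs_of_pos (by positivity)]
    nlinarith
  have hspeed : ∀ᶠ t in atTop, ∀ i, |v i t| ≤ |ω i| + K + 1 :=
    eventually_all.2 fun i => eventually_abs_le_of_relaxation hm (lt_add_one _) (hv i) (hforce i)
  obtain ⟨S, hS⟩ := eventually_atTop.1 (hspeed.and (eventually_ge_atTop T))
  have hST : T ≤ S := (hS S le_rfl).2
  have hu : ∀ i t, S ≤ t → |v i t - Ω| ≤ |ω i| + K + 1 + |Ω| := fun i t ht =>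
    (abs_sub _ _).trans (add_le_add ((hS t ht).1 i) le_rfl)
  have ha : ∀ i t, S ≤ t → |a i t| ≤ (2 * (|ω i| + K) + 1) / m := fun i t ht => by
    rw [le_div_iff₀ hm, mul_comm, ← abs_of_pos hm, ← abs_mul]
    have h1 := abs_le.1 (hforce i t (hT.trans (hST.trans ht)))
    have h2 := abs_le.1 ((hS t ht).1 i)
    rw [abs_le]
    constructor <;> linarith
  have hsq : ∀ i t, HasDerivAt (fun s => (v i s - Ω) ^ 2) (2 * (v i t - Ω) * a i t) t :=
    fun i t => by simpa using ((hv i t).sub_const Ω).fun_pow 2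
  have hlim : Tendsto (fun t => ∑ i, (v i t - Ω) ^ 2) atTop (nhds 0) := by
    refine tendsto_zero_of_dissipation (T := S)
      (f' := fun t => ∑ i, 2 * (v i t - Ω) * a i t)
      (E := fun t => m / 2 * ∑ i, (v i t - Ω) ^ 2
        - ((ω 1 - Ω) * (θ 1 t - θ 0 t) + (ω 2 - Ω) * (θ 2 t - θ 0 t))
        - K / 3 * (cos (θ 0 t - θ 1 t) + cos (θ 0 t - θ 2 t) + cos (θ 1 t - θ 2 t)))
      (L := -(|ω 1 - Ω| * C + |ω 2 - Ω| * C) - K)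
      (C := ∑ i, 2 * (|ω i| + K + 1 + |Ω|) * ((2 * (|ω i| + K) + 1) / m))
      ?_ ?_ ?_ ?_ ?_
    · intro t ht
      have hcos : ∀ i j, HasDerivAt (fun s => cos (θ i s - θ j s))
          (-sin (θ i t - θ j t) * (v i t - v j t)) t := fun i j => ((hθ i t).sub (hθ j t)).cos
      have ht0 := hT.trans (hST.trans ht)
      have h0 := hode 0 t ht0
      have h1 := hode 1 t ht0
      have h2 := hode 2 t ht0
      rw [Fin.sum_univ_three] at h0 h1 h2
      have e1 : sin (θ 1 t - θ 0 t) = -sin (θ 0 t - θ 1 t) := by rw [← sin_neg, neg_sub]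
      have e2 : sin (θ 2 t - θ 0 t) = -sin (θ 0 t - θ 2 t) := by rw [← sin_neg, neg_sub]
      have e3 : sin (θ 2 t - θ 1 t) = -sin (θ 1 t - θ 2 t) := by rw [← sin_neg, neg_sub]
      simp only [e1, e2, e3, sub_self, sin_zero] at h0 h1 h2
      refine ((((HasDerivAt.fun_sum fun i _ => hsq i t).const_mul (m / 2)).sub
        ((((hθ 1 t).sub (hθ 0 t)).const_mul (ω 1 - Ω)).add
          (((hθ 2 t).sub (hθ 0 t)).const_mul (ω 2 - Ω)))).sub
        ((((hcos 0 1).add (hcos 0 2)).add (hcos 1 2)).const_mul (K / 3))).congr_deriv ?_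
      rw [Fin.sum_univ_three, Fin.sum_univ_three]
      linear_combination (v 0 t - Ω) * h0 + (v 1 t - Ω) * h1 + (v 2 t - Ω) * h2
        + (v 0 t - Ω) * hΩ'
    · exact fun t _ => HasDerivAt.fun_sum fun i _ => hsq i t
    · exact fun t _ => Finset.sum_nonneg fun i _ => sq_nonneg _
    · intro t ht
      have hlin : ∀ i, (ω i - Ω) * (θ i t - θ 0 t) ≤ |ω i - Ω| * C := fun i =>
        (le_abs_self _).trans (by
          rw [abs_mul]
          exact mul_le_mul_of_nonneg_left (hC t (hST.trans ht) i 0) (abs_nonneg _))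
      have hsq : 0 ≤ m / 2 * ∑ i, (v i t - Ω) ^ 2 :=
        mul_nonneg (by positivity) (Finset.sum_nonneg fun i _ => sq_nonneg _)
      have hcos : K / 3 * (cos (θ 0 t - θ 1 t) + cos (θ 0 t - θ 2 t) + cos (θ 1 t - θ 2 t))
          ≤ K / 3 * 3 := mul_le_mul_of_nonneg_left
        (by linarith [cos_le_one (θ 0 t - θ 1 t), cos_le_one (θ 0 t - θ 2 t),
          cos_le_one (θ 1 t - θ 2 t)]) (by positivity)
      linarith [hlin 1, hlin 2]
    · intro t ht
      refine (Finset.abs_sum_le_sum_abs _ _).trans (Finset.sum_le_sum fun i _ => ?_)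
      rw [abs_mul, abs_mul, abs_two]
      exact mul_le_mul (mul_le_mul_of_nonneg_left (hu i t ht) zero_le_two) (ha i t ht)
        (abs_nonneg _) (by positivity)
  intro i
  have hsq : Tendsto (fun t => (v i t - Ω) ^ 2) atTop (nhds 0) :=
    squeeze_zero (fun t => sq_nonneg _) (fun t => Finset.single_le_sum
      (f := fun i => (v i t - Ω) ^ 2) (fun _ _ => sq_nonneg _) (Finset.mem_univ i)) hlim
  have habs : Tendsto (fun t => |v i t - Ω|) atTop (nhds 0) := by
    simpa [sqrt_sq_eq_abs] using hsq.sqrt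
  exact tendsto_sub_nhds_zero_iff.1 ((tendsto_zero_iff_abs_tendsto_zero _).2 habs)

/-- Theorem 1.10 (unconditional complete frequency synchronization for three
nonidentical oscillators): with `α₃ = 2π/5` and
`λ₃ = (9/10) sin(α₃/16) cos(11α₃/16)`, if `mK` is small enough and
`D(Ω) < λ₃ K`, then every solution (for arbitrary initial phases and
velocities) satisfies `θᵢ'(t) → ω` as `t → ∞` for all `i`. -/
theorem kuramoto_three_oscillators_unconditional_sync
    (m K : ℝ) (hm : 0 < m) (hK : 0 < K)
    (hmK : m * K ≤ (2 * Real.pi / 5)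
        / (4 * (Real.sin ((2 * Real.pi / 5) / 16) * Real.cos (11 * (2 * Real.pi / 5) / 16) + 2)
          * Real.log ((4 * Real.sin ((2 * Real.pi / 5) / 16)
              * Real.cos (11 * (2 * Real.pi / 5) / 16) + 6)
            / (Real.sin ((2 * Real.pi / 5) / 16) * Real.cos (11 * (2 * Real.pi / 5) / 16)))))
    (ω : Fin 3 → ℝ)
    (hΩ : diam ω
        < 9 / 10 * Real.sin ((2 * Real.pi / 5) / 16)
            * Real.cos (11 * (2 * Real.pi / 5) / 16) * K)
    (θ : Fin 3 → ℝ → ℝ)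
    (hsmooth : ∀ i, ContDiff ℝ 2 (θ i))
    (hode : ∀ i, ∀ t : ℝ, 0 ≤ t →
      m * deriv (deriv (θ i)) t + deriv (θ i) t
        = ω i + K / 3 * ∑ j, Real.sin (θ j t - θ i t)) :
    ∀ i, Tendsto (deriv (θ i)) atTop (nhds ((1 / 3 : ℝ) * ∑ k, ω k)) := by
  obtain ⟨hs0, hs1⟩ := sin_mul_cos_bounds
  have hmK' : m * K ≤ 1 / 25 := by
    refine hmK.trans ?_
    rw [mul_assoc 4 (sin _) (cos _)]
    exact inertia_threshold_le hs0 hs1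
  have hω : ∀ i j, ω i - ω j < K / 10 := fun i j => by
    refine (sub_le_diam ω i j).trans_lt (hΩ.trans ?_)
    nlinarith
  have hω' : ∀ i j, |ω i - ω j| < K / 10 := fun i j =>
    abs_lt.2 ⟨by linarith [hω j i], hω i j⟩
  have hθ : ∀ i t, HasDerivAt (θ i) (deriv (θ i) t) t := fun i t =>
    ((hsmooth i).differentiable (by norm_num) t).hasDerivAt
  have hv : ∀ i t, HasDerivAt (deriv (θ i)) (deriv (deriv (θ i)) t) t := fun i t => by
    have : ContDiff ℝ 1 (deriv (θ i)) := (contDiff_succ_iff_deriv.1 (hsmooth i)).2.2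
    exact (this.differentiable (by norm_num) t).hasDerivAt
  obtain ⟨C, T, hT, hC⟩ := phase_differences_bounded hm hK hmK' hω' hθ hv hode
  exact sync_of_phase_differences_bounded hm hK hθ hv hode hT hC
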